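/- arXiv:1506.04514 — 5 statements merged into one kernel-verified Lean document; each statement's English description precedes it below -/
import Mathlib

section
/- Let X be a nonempty finite type, let γ be a real number with 0 ≤ γ < 1, let M1 and M2 be X-by-X row-stochastic real matrices, let r1, r2 : X → ℝ, and set V1 = (1 − γ·M1)⁻¹ ⬝ r1 and V2 = (1 − γ·M2)⁻¹ ⬝ r2. Then V1 − V2 = (1 − γ·M1)⁻¹ ⬝ (r1 − r2 + γ·(M1 − M2) ⬝ V2). -/
open Matrix

theorem isUnit_det_aux {X : Type*} [Fintype X] [DecidableEq X]
    (γ : ℝ) (hγ0 : 0 ≤ γ) (hγ1 : γ < 1) (M : Matrix X X ℝ)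
    (hM0 : ∀ x x', 0 ≤ M x x') (hM1 : ∀ x, ∑ x', M x x' = 1) :
    IsUnit ((1 : Matrix X X ℝ) - γ • M).det := by
  rw [isUnit_iff_ne_zero]
  apply det_ne_zero_of_sum_row_lt_diag
  intro k
  have h1 : ∑ j ∈ Finset.univ.erase k, ‖((1 : Matrix X X ℝ) - γ • M) k j‖
      = γ * ∑ j ∈ Finset.univ.erase k, M k j := by
    rw [Finset.mul_sum]
    refine Finset.sum_congr rfl fun j hj => ?_
    have hne : k ≠ j := (Finset.ne_of_mem_erase hj).symm
    simp [Matrix.one_apply_ne hne, abs_of_nonneg hγ0, abs_of_nonneg (hM0 k j)]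
  have h2 : M k k + ∑ j ∈ Finset.univ.erase k, M k j = 1 := by
    rw [Finset.add_sum_erase _ _ (Finset.mem_univ k), hM1]
  have h3 : ((1 : Matrix X X ℝ) - γ • M) k k = 1 - γ * M k k := by simp
  rw [h1, h3]
  refine lt_of_lt_of_le ?_ (Real.le_norm_self _)
  have : γ * M k k + γ * ∑ j ∈ Finset.univ.erase k, M k j = γ := by
    rw [← mul_add, h2, mul_one]
  linarith

/-- For row-stochastic `M1, M2` and `0 ≤ γ < 1`, with
`V1 = (1 - γ•M1)⁻¹ *ᵥ r1` and `V2 = (1 - γ•M2)⁻¹ *ᵥ r2`, we have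
`V1 - V2 = (1 - γ•M1)⁻¹ *ᵥ (r1 - r2 + γ • ((M1 - M2) *ᵥ V2))`. -/
theorem value_diff_eq
    {X : Type*} [Fintype X] [Nonempty X] [DecidableEq X]
    (γ : ℝ) (hγ0 : 0 ≤ γ) (hγ1 : γ < 1)
    (M1 M2 : Matrix X X ℝ)
    (hM10 : ∀ x x', 0 ≤ M1 x x') (hM11 : ∀ x, ∑ x', M1 x x' = 1)
    (hM20 : ∀ x x', 0 ≤ M2 x x') (hM21 : ∀ x, ∑ x', M2 x x' = 1)
    (r1 r2 : X → ℝ)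
    (V1 V2 : X → ℝ)
    (hV1 : V1 = ((1 : Matrix X X ℝ) - γ • M1)⁻¹ *ᵥ r1)
    (hV2 : V2 = ((1 : Matrix X X ℝ) - γ • M2)⁻¹ *ᵥ r2) :
    V1 - V2 = ((1 : Matrix X X ℝ) - γ • M1)⁻¹ *ᵥ (r1 - r2 + γ • ((M1 - M2) *ᵥ V2)) := by
  have u1 := isUnit_det_aux γ hγ0 hγ1 M1 hM10 hM11
  have u2 := isUnit_det_aux γ hγ0 hγ1 M2 hM20 hM21
  have e2 : ((1 : Matrix X X ℝ) - γ • M2) *ᵥ V2 = r2 := by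
    rw [hV2, Matrix.mulVec_mulVec, Matrix.mul_nonsing_inv _ u2, Matrix.one_mulVec]
  have e : r1 - r2 + γ • ((M1 - M2) *ᵥ V2) = r1 - ((1 : Matrix X X ℝ) - γ • M1) *ᵥ V2 := by
    rw [← e2]
    simp only [Matrix.sub_mulVec, Matrix.smul_mulVec, Matrix.one_mulVec, smul_sub]
    abel
  rw [e, Matrix.mulVec_sub, ← hV1, Matrix.mulVec_mulVec, Matrix.nonsing_inv_mul _ u1,
    Matrix.one_mulVec]
end

section
/- (Lemma, bound on value difference under transition and reward perturbations.) Let X be a nonempty finite type, γ a real with 0 ≤ γ < 1, M1 and M2 X-by-X row-stochastic real matrices, Rmax ≥ 0, and r1, r2 : X → ℝ with |r2 x| ≤ Rmax for all x. Suppose g : X → ℝ satisfies ∑_{x'} |M1 x x' − M2 x x'| ≤ g x for every x. Set V1 = (1 − γ·M1)⁻¹ ⬝ r1 and V2 = (1 − γ·M2)⁻¹ ⬝ r2. Then, entrywise, (1 − γ·M1)⁻¹ ⬝ (r1 − r2 − (γ·Rmax/(1−γ))·g) ≤ V1 − V2 ≤ (1 − γ·M1)⁻¹ ⬝ (r1 −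 r2 + (γ·Rmax/(1−γ))·g). -/
open Matrix

theorem vd_apply {X : Type*} [Fintype X] [DecidableEq X] (γ : ℝ) (M : Matrix X X ℝ)
    (u : X → ℝ) (x : X) :
    (((1 : Matrix X X ℝ) - γ • M) *ᵥ u) x = u x - γ * ∑ y, M x y * u y := by
  rw [Matrix.sub_mulVec, Matrix.one_mulVec, Matrix.smul_mulVec]
  simp [Matrix.mulVec, dotProduct]

theorem vd_max {X : Type*} [Fintype X] [Nonempty X] [DecidableEq X]
    (γ : ℝ) (hγ0 : 0 ≤ γ) (hγ1 : γ < 1) (M : Matrix X X ℝ)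
    (h0 : ∀ x x', 0 ≤ M x x') (h1 : ∀ x, ∑ x', M x x' = 1) (u : X → ℝ)
    (hu : ∀ x, 0 ≤ (((1 : Matrix X X ℝ) - γ • M) *ᵥ u) x) : ∀ x, 0 ≤ u x := by
  obtain ⟨z, hz⟩ := Finite.exists_min u
  have h := hu z
  rw [vd_apply] at h
  have hs : u z ≤ ∑ y, M z y * u y := by
    calc u z = ∑ y, M z y * u z := by rw [← Finset.sum_mul, h1, one_mul]
      _ ≤ _ := Finset.sum_le_sum fun y _ => mul_le_mul_of_nonneg_left (hz y) (h0 z y)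
  have h2 := mul_le_mul_of_nonneg_left hs hγ0
  have h3 : 0 ≤ u z := by
    by_contra hc
    push Not at hc
    nlinarith
  exact fun x => h3.trans (hz x)

theorem vd_unit {X : Type*} [Fintype X] [Nonempty X] [DecidableEq X]
    (γ : ℝ) (hγ0 : 0 ≤ γ) (hγ1 : γ < 1) (M : Matrix X X ℝ)
    (h0 : ∀ x x', 0 ≤ M x x') (h1 : ∀ x, ∑ x', M x x' = 1) (v : X → ℝ) :
    ((1 : Matrix X X ℝ) - γ • M) *ᵥ (((1 : Matrix X X ℝ) - γ • M)⁻¹ *ᵥ v) = v := by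
  have hU : IsUnit ((1 : Matrix X X ℝ) - γ • M) := by
    rw [← Matrix.mulVec_injective_iff_isUnit]
    intro a b hab
    have hab' : ∀ x, (((1 : Matrix X X ℝ) - γ • M) *ᵥ a) x
        = (((1 : Matrix X X ℝ) - γ • M) *ᵥ b) x := fun x => congrFun hab x
    have ha := vd_max γ hγ0 hγ1 M h0 h1 (a - b) (fun x => by
      rw [Matrix.mulVec_sub, Pi.sub_apply, hab' x, sub_self])
    have hb := vd_max γ hγ0 hγ1 M h0 h1 (b - a) (fun x => by
      rw [Matrix.mulVec_sub, Pi.sub_apply, hab' x, sub_self])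
    funext x
    have h2 := ha x
    have h3 := hb x
    simp only [Pi.sub_apply] at h2 h3
    linarith
  rw [Matrix.mulVec_mulVec, Matrix.mul_nonsing_inv _ ((Matrix.isUnit_iff_isUnit_det _).1 hU),
    Matrix.one_mulVec]

/-- Entrywise bounds on the difference of value functions under
transition and reward perturbations. -/
theorem value_diff_entrywise_bounds
    {X : Type*} [Fintype X] [Nonempty X] [DecidableEq X]
    (γ : ℝ) (hγ0 : 0 ≤ γ) (hγ1 : γ < 1)
    (M1 M2 : Matrix X X ℝ)
    (hM10 : ∀ x x', 0 ≤ M1 x x') (hM11 : ∀ x, ∑ x', M1 x x' = 1)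
    (hM20 : ∀ x x', 0 ≤ M2 x x') (hM21 : ∀ x, ∑ x', M2 x x' = 1)
    (Rmax : ℝ) (hR : 0 ≤ Rmax)
    (r1 r2 : X → ℝ) (hr2 : ∀ x, |r2 x| ≤ Rmax)
    (g : X → ℝ) (hg : ∀ x, ∑ x', |M1 x x' - M2 x x'| ≤ g x)
    (V1 V2 : X → ℝ)
    (hV1 : V1 = ((1 : Matrix X X ℝ) - γ • M1)⁻¹ *ᵥ r1)
    (hV2 : V2 = ((1 : Matrix X X ℝ) - γ • M2)⁻¹ *ᵥ r2) :
    ∀ x,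
      (((1 : Matrix X X ℝ) - γ • M1)⁻¹ *ᵥ (r1 - r2 - (γ * Rmax / (1 - γ)) • g)) x
          ≤ V1 x - V2 x ∧
      V1 x - V2 x
          ≤ (((1 : Matrix X X ℝ) - γ • M1)⁻¹ *ᵥ (r1 - r2 + (γ * Rmax / (1 - γ)) • g)) x := by
  have e1 : ((1 : Matrix X X ℝ) - γ • M1) *ᵥ V1 = r1 := by
    rw [hV1]; exact vd_unit γ hγ0 hγ1 M1 hM10 hM11 r1
  have e2 : ((1 : Matrix X X ℝ) - γ • M2) *ᵥ V2 = r2 := by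
    rw [hV2]; exact vd_unit γ hγ0 hγ1 M2 hM20 hM21 r2
  have hpos : 0 < 1 - γ := by linarith
  have hconst : ∀ x, (((1 : Matrix X X ℝ) - γ • M2) *ᵥ (fun _ => Rmax / (1 - γ))) x = Rmax := by
    intro x
    rw [vd_apply, ← Finset.sum_mul, hM21]
    field_simp
  have b1 := vd_max γ hγ0 hγ1 M2 hM20 hM21 ((fun _ => Rmax / (1 - γ)) - V2) (fun x => by
    rw [Matrix.mulVec_sub, Pi.sub_apply, hconst, e2]
    linarith [(abs_le.1 (hr2 x)).2])
  have b2 := vd_max γ hγ0 hγ1 M2 hM20 hM21 ((fun _ => Rmax / (1 - γ)) + V2) (fun x => by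
    rw [Matrix.mulVec_add, Pi.add_apply, hconst, e2]
    linarith [(abs_le.1 (hr2 x)).1])
  have hb : ∀ x, |V2 x| ≤ Rmax / (1 - γ) := by
    intro x
    have h1 := b1 x
    have h2 := b2 x
    simp only [Pi.sub_apply, Pi.add_apply] at h1 h2
    exact abs_le.2 ⟨by linarith, by linarith⟩
  have hc : 0 ≤ Rmax / (1 - γ) := by positivity
  have hd : ∀ x, |γ * ∑ y, (M1 x y - M2 x y) * V2 y| ≤ γ * Rmax / (1 - γ) * g x := by
    intro x
    rw [abs_mul, abs_of_nonneg hγ0, mul_div_assoc, mul_assoc]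
    refine mul_le_mul_of_nonneg_left ?_ hγ0
    calc |∑ y, (M1 x y - M2 x y) * V2 y| ≤ ∑ y, |(M1 x y - M2 x y) * V2 y| :=
          Finset.abs_sum_le_sum_abs _ _
      _ ≤ ∑ y, |M1 x y - M2 x y| * (Rmax / (1 - γ)) := Finset.sum_le_sum fun y _ => by
          rw [abs_mul]; exact mul_le_mul_of_nonneg_left (hb y) (abs_nonneg _)
      _ = (∑ y, |M1 x y - M2 x y|) * (Rmax / (1 - γ)) := by rw [Finset.sum_mul]
      _ ≤ g x * (Rmax / (1 - γ)) := mul_le_mul_of_nonneg_right (hg x) hc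
      _ = _ := mul_comm _ _
  have hA : ∀ x, (((1 : Matrix X X ℝ) - γ • M1) *ᵥ (V1 - V2)) x
      = r1 x - r2 x + γ * ∑ y, (M1 x y - M2 x y) * V2 y := by
    intro x
    have h2 := congrFun e2 x
    rw [vd_apply] at h2
    rw [Matrix.mulVec_sub, Pi.sub_apply, e1, vd_apply]
    simp only [sub_mul, Finset.sum_sub_distrib]
    linarith
  have lo := vd_max γ hγ0 hγ1 M1 hM10 hM11
    ((V1 - V2) - ((1 : Matrix X X ℝ) - γ • M1)⁻¹ *ᵥ (r1 - r2 - (γ * Rmax / (1 - γ)) • g))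
    (fun x => by
      rw [Matrix.mulVec_sub, vd_unit γ hγ0 hγ1 M1 hM10 hM11, Pi.sub_apply, hA]
      simp only [Pi.sub_apply, Pi.smul_apply, smul_eq_mul]
      linarith [(abs_le.1 (hd x)).1])
  have hi := vd_max γ hγ0 hγ1 M1 hM10 hM11
    (((1 : Matrix X X ℝ) - γ • M1)⁻¹ *ᵥ (r1 - r2 + (γ * Rmax / (1 - γ)) • g) - (V1 - V2))
    (fun x => by
      rw [Matrix.mulVec_sub, vd_unit γ hγ0 hγ1 M1 hM10 hM11, Pi.sub_apply, hA]
      simp only [Pi.add_apply, Pi.sub_apply, Pi.smul_apply, smul_eq_mul]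
      linarith [(abs_le.1 (hd x)).2])
  intro x
  have h1 := lo x
  have h2 := hi x
  rw [Pi.sub_apply, Pi.sub_apply] at h1 h2
  exact ⟨by linarith, by linarith⟩
end

section
/- (Lemma 1 of the paper.) Under Assumption 1, for every policy π, the difference between the returns of π under the simulated and the true kernel satisfies |ρ(π, P̂, r) − ρ(π, P⋆, r)| ≤ (γ·Rmax/(1−γ)) · ∑_x ∑_y p0 y · ((1 − γ·P⋆_π)⁻¹) y x · e_π x, where P⋆_π is the matrix induced by π from P⋆ and e_π x = ∑_a π x a · e x a. -/
open Matrix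

/-- The row-stochastic matrix induced by a policy `π` from a transition kernel `P`. -/
noncomputable def polMat {X A : Type*} [Fintype A]
    (P : X → A → X → ℝ) (π : X → A → ℝ) : Matrix X X ℝ :=
  Matrix.of fun x x' => ∑ a, π x a * P x a x'

/-- The reward vector induced by a policy `π` from a reward function `r`. -/
noncomputable def polRew {X A : Type*} [Fintype A]
    (r : X → A → ℝ) (π : X → A → ℝ) : X → ℝ :=
  fun x => ∑ a, π x a * r x a

/-- The value function `V^π_{P,r} = (1 - γ • P_π)⁻¹ *ᵥ r_π`. -/
noncomputable def valueFn {X A : Type*} [Fintype X] [DecidableEq X] [Fintype A]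
    (γ : ℝ) (P : X → A → X → ℝ) (r : X → A → ℝ) (π : X → A → ℝ) : X → ℝ :=
  ((1 : Matrix X X ℝ) - γ • polMat P π)⁻¹ *ᵥ polRew r π

/-- The return `ρ(π, P, r) = ∑ x, p0 x * V^π_{P,r} x`. -/
noncomputable def ret {X A : Type*} [Fintype X] [DecidableEq X] [Fintype A]
    (p0 : X → ℝ) (γ : ℝ) (P : X → A → X → ℝ) (r : X → A → ℝ) (π : X → A → ℝ) : ℝ :=
  ∑ x, p0 x * valueFn γ P r π x

/-- A transition kernel: nonnegative entries, each row summing to one. -/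
def IsKernel {X A : Type*} [Fintype X] (P : X → A → X → ℝ) : Prop :=
  (∀ x a x', 0 ≤ P x a x') ∧ ∀ x a, ∑ x', P x a x' = 1

/-- A randomized stationary policy. -/
def IsPolicy {X A : Type*} [Fintype A] (π : X → A → ℝ) : Prop :=
  (∀ x a, 0 ≤ π x a) ∧ ∀ x, ∑ a, π x a = 1

/-- The error function `e_π x = ∑ a, π x a * e x a` induced by a policy. -/
noncomputable def polErr {X A : Type*} [Fintype A]
    (e : X → A → ℝ) (π : X → A → ℝ) : X → ℝ :=
  fun x => ∑ a, π x a * e x a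

/-- The normalized state occupancy frequency
`u^π_P x = (1 - γ) * ∑ y, p0 y * ((1 - γ • P_π)⁻¹) y x`. -/
noncomputable def occupancy {X A : Type*} [Fintype X] [DecidableEq X] [Fintype A]
    (p0 : X → ℝ) (γ : ℝ) (P : X → A → X → ℝ) (π : X → A → ℝ) : X → ℝ :=
  fun x => (1 - γ) * ∑ y, p0 y * ((1 : Matrix X X ℝ) - γ • polMat P π)⁻¹ y x

lemma disc_min {X : Type*} [Fintype X] [Nonempty X] [DecidableEq X]
    (γ : ℝ) (hγ0 : 0 ≤ γ) (hγ1 : γ < 1) (M : Matrix X X ℝ)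
    (hM0 : ∀ x y, 0 ≤ M x y) (hM1 : ∀ x, ∑ y, M x y = 1) (v : X → ℝ) (c : ℝ)
    (h : ∀ x, c ≤ (((1 : Matrix X X ℝ) - γ • M) *ᵥ v) x) (x : X) : c / (1 - γ) ≤ v x := by
  obtain ⟨z, hz⟩ := Finite.exists_min v
  have h1 := h z
  have h2 : v z ≤ (M *ᵥ v) z := by
    have : v z = ∑ y, M z y * v z := by rw [← Finset.sum_mul, hM1, one_mul]
    rw [this]
    exact Finset.sum_le_sum fun y _ => mul_le_mul_of_nonneg_left (hz y) (hM0 z y)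
  rw [Matrix.sub_mulVec, Matrix.one_mulVec, Matrix.smul_mulVec] at h1
  simp only [Pi.sub_apply, Pi.smul_apply, smul_eq_mul] at h1
  have h3 := mul_le_mul_of_nonneg_left h2 hγ0
  refine le_trans ?_ (hz x)
  rw [div_le_iff₀ (by linarith)]
  linarith

lemma disc_unit {X : Type*} [Fintype X] [Nonempty X] [DecidableEq X]
    (γ : ℝ) (hγ0 : 0 ≤ γ) (hγ1 : γ < 1) (M : Matrix X X ℝ)
    (hM0 : ∀ x y, 0 ≤ M x y) (hM1 : ∀ x, ∑ y, M x y = 1) :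
    IsUnit ((1 : Matrix X X ℝ) - γ • M).det := by
  rw [isUnit_iff_ne_zero]
  intro hdet
  obtain ⟨v, hv, hv0⟩ := Matrix.exists_mulVec_eq_zero_iff.mpr hdet
  apply hv
  funext x
  have h1 := disc_min γ hγ0 hγ1 M hM0 hM1 v 0 (fun x => by simp [hv0]) x
  have h2 := disc_min γ hγ0 hγ1 M hM0 hM1 (-v) 0 (fun x => by simp [Matrix.mulVec_neg, hv0]) x
  simp at h1 h2
  exact le_antisymm h2 h1

lemma polMat_nonneg {X A : Type*} [Fintype X] [Fintype A] (P : X → A → X → ℝ) (π : X → A → ℝ)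
    (hP : IsKernel P) (hπ : IsPolicy π) (x y : X) : 0 ≤ polMat P π x y :=
  Finset.sum_nonneg fun a _ => mul_nonneg (hπ.1 x a) (hP.1 x a y)

lemma polMat_sum {X A : Type*} [Fintype X] [Fintype A] (P : X → A → X → ℝ) (π : X → A → ℝ)
    (hP : IsKernel P) (hπ : IsPolicy π) (x : X) : ∑ y, polMat P π x y = 1 := by
  simp only [polMat, Matrix.of_apply]
  rw [Finset.sum_comm]
  simp only [← Finset.mul_sum, hP.2, mul_one, hπ.2]

/-- Lemma 1: Under Assumption 1, for every policy `π`,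
`|ρ(π, P̂, r) − ρ(π, P⋆, r)| ≤ (γ Rmax/(1−γ)) ∑_x ∑_y p0 y ((1 − γ P⋆_π)⁻¹) y x · e_π x`. -/
theorem return_diff_le
    {X A : Type*} [Fintype X] [Nonempty X] [DecidableEq X] [Fintype A] [Nonempty A]
    (γ : ℝ) (hγ0 : 0 ≤ γ) (hγ1 : γ < 1)
    (Rmax : ℝ) (hR : 0 ≤ Rmax)
    (r : X → A → ℝ) (hr : ∀ x a, |r x a| ≤ Rmax)
    (p0 : X → ℝ) (hp0 : ∀ x, 0 ≤ p0 x) (hp1 : ∑ x, p0 x = 1)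
    (Pstar Phat : X → A → X → ℝ) (hPstar : IsKernel Pstar) (hPhat : IsKernel Phat)
    (e : X → A → ℝ)
    (hAsm : ∀ x a, ∑ x', |Pstar x a x' - Phat x a x'| ≤ e x a)
    (π : X → A → ℝ) (hπ : IsPolicy π) :
    |ret p0 γ Phat r π - ret p0 γ Pstar r π| ≤
      γ * Rmax / (1 - γ) *
        ∑ x, ∑ y, p0 y * ((1 : Matrix X X ℝ) - γ • polMat Pstar π)⁻¹ y x * polErr e π x := by
  have hs0 := polMat_nonneg Pstar π hPstar hπ
  have hs1 := polMat_sum Pstar π hPstar hπ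
  have hh0 := polMat_nonneg Phat π hPhat hπ
  have hh1 := polMat_sum Phat π hPhat hπ
  have us := disc_unit γ hγ0 hγ1 _ hs0 hs1
  have uh := disc_unit γ hγ0 hγ1 _ hh0 hh1
  have hg : 0 < 1 - γ := by linarith
  set C : ℝ := γ * Rmax / (1 - γ) with hC
  set Vh := valueFn γ Phat r π with hVh
  set Vs := valueFn γ Pstar r π with hVs
  have eh : ((1 : Matrix X X ℝ) - γ • polMat Phat π) *ᵥ Vh = polRew r π := by
    rw [hVh, valueFn, Matrix.mulVec_mulVec, Matrix.mul_nonsing_inv _ uh, Matrix.one_mulVec]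
  have es : ((1 : Matrix X X ℝ) - γ • polMat Pstar π) *ᵥ Vs = polRew r π := by
    rw [hVs, valueFn, Matrix.mulVec_mulVec, Matrix.mul_nonsing_inv _ us, Matrix.one_mulVec]
  set E : X → ℝ := ((1 : Matrix X X ℝ) - γ • polMat Pstar π)⁻¹ *ᵥ polErr e π with hE
  have eE : ((1 : Matrix X X ℝ) - γ • polMat Pstar π) *ᵥ E = polErr e π := by
    rw [hE, Matrix.mulVec_mulVec, Matrix.mul_nonsing_inv _ us, Matrix.one_mulVec]
  have hrew : ∀ x, |polRew r π x| ≤ Rmax := by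
    intro x
    calc |polRew r π x| ≤ ∑ a, |π x a * r x a| := Finset.abs_sum_le_sum_abs _ _
      _ ≤ ∑ a, π x a * Rmax := by
          refine Finset.sum_le_sum fun a _ => ?_
          rw [abs_mul, abs_of_nonneg (hπ.1 x a)]
          exact mul_le_mul_of_nonneg_left (hr x a) (hπ.1 x a)
      _ = Rmax := by rw [← Finset.sum_mul, hπ.2, one_mul]
  have hVb : ∀ x, |Vh x| ≤ Rmax / (1 - γ) := by
    intro x
    have h1 := disc_min γ hγ0 hγ1 _ hh0 hh1 Vh (-Rmax)
      (fun x => by rw [eh]; exact (abs_le.mp (hrew x)).1) x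
    have h2 := disc_min γ hγ0 hγ1 _ hh0 hh1 (-Vh) (-Rmax)
      (fun x => by
        rw [Matrix.mulVec_neg, eh, Pi.neg_apply]
        exact neg_le_neg (abs_le.mp (hrew x)).2) x
    rw [Pi.neg_apply] at h2
    rw [neg_div] at h1 h2
    exact abs_le.mpr ⟨h1, by linarith⟩
  have hrow : ∀ x, ∑ y, |polMat Phat π x y - polMat Pstar π x y| ≤ polErr e π x := by
    intro x
    calc ∑ y, |polMat Phat π x y - polMat Pstar π x y|
        ≤ ∑ y, ∑ a, π x a * |Pstar x a y - Phat x a y| := by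
          refine Finset.sum_le_sum fun y _ => ?_
          simp only [polMat, Matrix.of_apply]
          rw [← Finset.sum_sub_distrib]
          refine (Finset.abs_sum_le_sum_abs _ _).trans (Finset.sum_le_sum fun a _ => ?_)
          rw [← mul_sub, abs_mul, abs_of_nonneg (hπ.1 x a), abs_sub_comm]
      _ = ∑ a, π x a * ∑ y, |Pstar x a y - Phat x a y| := by
          rw [Finset.sum_comm]
          simp only [Finset.mul_sum]
      _ ≤ polErr e π x :=
          Finset.sum_le_sum fun a _ => mul_le_mul_of_nonneg_left (hAsm x a) (hπ.1 x a)
  have eD : ((1 : Matrix X X ℝ) - γ • polMat Pstar π) *ᵥ (Vh - Vs)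
      = γ • ((polMat Phat π - polMat Pstar π) *ᵥ Vh) := by
    rw [Matrix.mulVec_sub, es, ← eh]
    simp only [Matrix.sub_mulVec, Matrix.smul_mulVec, smul_sub]
    abel
  have hgb : ∀ x, |(((1 : Matrix X X ℝ) - γ • polMat Pstar π) *ᵥ (Vh - Vs)) x|
      ≤ C * polErr e π x := by
    intro x
    rw [eD, Pi.smul_apply, smul_eq_mul, abs_mul, abs_of_nonneg hγ0]
    have : |((polMat Phat π - polMat Pstar π) *ᵥ Vh) x| ≤ polErr e π x * (Rmax / (1 - γ)) := by
      calc |((polMat Phat π - polMat Pstar π) *ᵥ Vh) x|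
          ≤ ∑ y, |(polMat Phat π - polMat Pstar π) x y * Vh y| := Finset.abs_sum_le_sum_abs _ _
        _ ≤ ∑ y, |polMat Phat π x y - polMat Pstar π x y| * (Rmax / (1 - γ)) := by
            refine Finset.sum_le_sum fun y _ => ?_
            rw [abs_mul, Matrix.sub_apply]
            exact mul_le_mul_of_nonneg_left (hVb y) (abs_nonneg _)
        _ ≤ _ := by
            rw [← Finset.sum_mul]
            exact mul_le_mul_of_nonneg_right (hrow x) (div_nonneg hR hg.le)
    calc _ ≤ γ * (polErr e π x * (Rmax / (1 - γ))) := mul_le_mul_of_nonneg_left this hγ0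
      _ = _ := by rw [hC]; ring
  have hD : ∀ x, |Vh x - Vs x| ≤ C * E x := by
    intro x
    have h1 := disc_min γ hγ0 hγ1 _ hs0 hs1 (C • E + (Vh - Vs)) 0
      (fun x => by
        rw [Matrix.mulVec_add, Matrix.mulVec_smul, eE, Pi.add_apply, Pi.smul_apply, smul_eq_mul]
        linarith [(abs_le.mp (hgb x)).1]) x
    have h2 := disc_min γ hγ0 hγ1 _ hs0 hs1 (C • E - (Vh - Vs)) 0
      (fun x => by
        rw [Matrix.mulVec_sub _ (C • E), Matrix.mulVec_smul, eE, Pi.sub_apply, Pi.smul_apply,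
          smul_eq_mul]
        linarith [(abs_le.mp (hgb x)).2]) x
    simp only [zero_div, Pi.add_apply, Pi.sub_apply, Pi.smul_apply, smul_eq_mul] at h1 h2
    exact abs_le.mpr ⟨by linarith, by linarith⟩
  have hRHS : ∑ x, ∑ y, p0 y * ((1 : Matrix X X ℝ) - γ • polMat Pstar π)⁻¹ y x * polErr e π x
      = ∑ y, p0 y * E y := by
    rw [Finset.sum_comm]
    refine Finset.sum_congr rfl fun y _ => ?_
    rw [hE, Matrix.mulVec, dotProduct, Finset.mul_sum]
    exact Finset.sum_congr rfl fun x _ => mul_assoc _ _ _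
  rw [hRHS, ret, ret, ← hVh, ← hVs, ← Finset.sum_sub_distrib, Finset.mul_sum]
  refine (Finset.abs_sum_le_sum_abs _ _).trans (Finset.sum_le_sum fun x _ => ?_)
  rw [← mul_sub, abs_mul, abs_of_nonneg (hp0 x)]
  calc _ ≤ p0 x * (C * E x) := mul_le_mul_of_nonneg_left (hD x) (hp0 x)
    _ = _ := by ring
end

section
/- (Key inequality for the reward-adjusted MDP.) Assume Assumption 1 holds and define the adjusted reward r̂ x a = r x a − (γ·Rmax/(1−γ)) · e x a. Then for every policy π, the return in the reward-adjusted simulated MDP is a lower bound on the true return: ρ(π, P̂, r̂) ≤ ρ(π, P⋆, r). -/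
open Matrix

lemma aux_nonneg {X : Type*} [Fintype X] [Nonempty X] (γ : ℝ) (hγ0 : 0 ≤ γ) (hγ1 : γ < 1)
    (M : Matrix X X ℝ) (hM : ∀ x y, 0 ≤ M x y) (hM1 : ∀ x, ∑ y, M x y = 1)
    (D : X → ℝ) (hD : ∀ x, γ * ∑ y, M x y * D y ≤ D x) (x : X) : 0 ≤ D x := by
  obtain ⟨m, hm⟩ := Finite.exists_min D
  have h1 : D m ≤ ∑ y, M m y * D y := by
    calc D m = ∑ y, M m y * D m := by rw [← Finset.sum_mul, hM1, one_mul]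
      _ ≤ _ := Finset.sum_le_sum fun y _ => mul_le_mul_of_nonneg_left (hm y) (hM m y)
  have h2 := hD m
  have h3 := mul_le_mul_of_nonneg_left h1 hγ0
  have h4 : 0 ≤ D m := by
    by_contra hc
    push Not at hc
    nlinarith
  exact h4.trans (hm x)

lemma aux_fix {X : Type*} [Fintype X] [Nonempty X] [DecidableEq X] (γ : ℝ) (hγ0 : 0 ≤ γ)
    (hγ1 : γ < 1)
    (M : Matrix X X ℝ) (hM : ∀ x y, 0 ≤ M x y) (hM1 : ∀ x, ∑ y, M x y = 1)
    (b : X → ℝ) (x : X) :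
    (((1 : Matrix X X ℝ) - γ • M)⁻¹ *ᵥ b) x
      = b x + γ * ∑ y, M x y * (((1 : Matrix X X ℝ) - γ • M)⁻¹ *ᵥ b) y := by
  have hu : IsUnit ((1 : Matrix X X ℝ) - γ • M) := by
    rw [← Matrix.mulVec_injective_iff_isUnit]
    have key : ∀ v w : X → ℝ, ((1 : Matrix X X ℝ) - γ • M) *ᵥ v = ((1 : Matrix X X ℝ) - γ • M) *ᵥ w
        → ∀ x, w x ≤ v x := by
      intro v w h x
      have := aux_nonneg γ hγ0 hγ1 M hM hM1 (fun x => v x - w x) (fun x => by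
        have := congrFun h x
        simp only [Matrix.sub_mulVec, Matrix.one_mulVec, Matrix.smul_mulVec, Pi.sub_apply,
          Pi.smul_apply, smul_eq_mul] at this
        simp only [Matrix.mulVec, dotProduct] at this
        simp only [mul_sub, Finset.sum_sub_distrib]
        linarith) x
      linarith
    intro v w h
    funext x
    exact le_antisymm (key w v h.symm x) (key v w h x)
  set V := ((1 : Matrix X X ℝ) - γ • M)⁻¹ *ᵥ b with hV
  have h : ((1 : Matrix X X ℝ) - γ • M) *ᵥ V = b := by
    rw [hV, Matrix.mulVec_mulVec, Matrix.mul_nonsing_inv _ ((Matrix.isUnit_iff_isUnit_det _).1 hu),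
      Matrix.one_mulVec]
  have := congrFun h x
  simp only [Matrix.sub_mulVec, Matrix.one_mulVec, Matrix.smul_mulVec, Pi.sub_apply,
    Pi.smul_apply, smul_eq_mul] at this
  simp only [Matrix.mulVec, dotProduct] at this
  linarith

lemma aux_polMat {X A : Type*} [Fintype X] [Fintype A] (P : X → A → X → ℝ) (π : X → A → ℝ)
    (hP : IsKernel P) (hπ : IsPolicy π) :
    (∀ x y, 0 ≤ polMat P π x y) ∧ ∀ x, ∑ y, polMat P π x y = 1 := by
  refine ⟨fun x y => Finset.sum_nonneg fun a _ => mul_nonneg (hπ.1 x a) (hP.1 x a y), fun x => ?_⟩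
  simp only [polMat, Matrix.of_apply]
  rw [Finset.sum_comm]
  simp only [← Finset.mul_sum, hP.2, mul_one, hπ.2]

lemma aux_expand {X A : Type*} [Fintype X] [Fintype A] (P : X → A → X → ℝ) (π : X → A → ℝ)
    (V : X → ℝ) (x : X) :
    ∑ y, polMat P π x y * V y = ∑ a, π x a * ∑ y, P x a y * V y := by
  simp only [polMat, Matrix.of_apply, Finset.sum_mul, Finset.mul_sum]
  rw [Finset.sum_comm]
  simp only [mul_assoc]

/-- the return in the reward-adjusted simulated MDP lower-bounds the
true return: `ρ(π, P̂, r̂) ≤ ρ(π, P⋆, r)` where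
`r̂ x a = r x a − (γ Rmax/(1−γ)) e x a`. -/
theorem reward_adjusted_return_le_true_return
    {X A : Type*} [Fintype X] [Nonempty X] [DecidableEq X] [Fintype A] [Nonempty A]
    (γ : ℝ) (hγ0 : 0 ≤ γ) (hγ1 : γ < 1)
    (Rmax : ℝ) (hR : 0 ≤ Rmax)
    (r : X → A → ℝ) (hr : ∀ x a, |r x a| ≤ Rmax)
    (p0 : X → ℝ) (hp0 : ∀ x, 0 ≤ p0 x) (hp1 : ∑ x, p0 x = 1)
    (Pstar Phat : X → A → X → ℝ) (hPstar : IsKernel Pstar) (hPhat : IsKernel Phat)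
    (e : X → A → ℝ)
    (hAsm : ∀ x a, ∑ x', |Pstar x a x' - Phat x a x'| ≤ e x a)
    (rhat : X → A → ℝ)
    (hrhat : ∀ x a, rhat x a = r x a - γ * Rmax / (1 - γ) * e x a)
    (π : X → A → ℝ) (hπ : IsPolicy π) :
    ret p0 γ Phat rhat π ≤ ret p0 γ Pstar r π := by
  obtain ⟨s0, s1⟩ := aux_polMat Pstar π hPstar hπ
  obtain ⟨t0, t1⟩ := aux_polMat Phat π hPhat hπ
  have hV := aux_fix γ hγ0 hγ1 _ s0 s1 (polRew r π)
  have hW := aux_fix γ hγ0 hγ1 _ t0 t1 (polRew rhat π)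
  refine Finset.sum_le_sum fun x _ => mul_le_mul_of_nonneg_left ?_ (hp0 x)
  unfold valueFn
  set V := ((1 : Matrix X X ℝ) - γ • polMat Pstar π)⁻¹ *ᵥ polRew r π
  set W := ((1 : Matrix X X ℝ) - γ • polMat Phat π)⁻¹ *ᵥ polRew rhat π
  have h1γ : 0 < 1 - γ := by linarith
  obtain ⟨K, hK⟩ : ∃ K, K = Rmax / (1 - γ) := ⟨_, rfl⟩
  have hKe : K = Rmax + γ * K := by rw [hK]; field_simp; ring
  have hrπ : ∀ x, |polRew r π x| ≤ Rmax := by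
    intro x
    calc |polRew r π x| ≤ ∑ a, |π x a * r x a| := Finset.abs_sum_le_sum_abs _ _
      _ ≤ ∑ a, π x a * Rmax := Finset.sum_le_sum fun a _ => by
          rw [abs_mul, abs_of_nonneg (hπ.1 x a)]
          exact mul_le_mul_of_nonneg_left (hr x a) (hπ.1 x a)
      _ = Rmax := by rw [← Finset.sum_mul, hπ.2, one_mul]
  have hVb : ∀ x, |V x| ≤ K := by
    intro x
    have u1 := aux_nonneg γ hγ0 hγ1 _ s0 s1 (fun x => K - V x) (fun x => by
      have := abs_le.1 (hrπ x)
      have := hV x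
      simp only [mul_sub, Finset.sum_sub_distrib, ← Finset.sum_mul, s1]
      linarith) x
    have u2 := aux_nonneg γ hγ0 hγ1 _ s0 s1 (fun x => K + V x) (fun x => by
      have := abs_le.1 (hrπ x)
      have := hV x
      simp only [mul_add, Finset.sum_add_distrib, ← Finset.sum_mul, s1]
      linarith) x
    rw [abs_le]
    constructor <;> linarith
  have hfin := aux_nonneg γ hγ0 hγ1 _ t0 t1 (fun x => V x - W x) (fun x => by
    have e1 := hV x
    have e2 := hW x
    have e3 : ∑ y, polMat Phat π x y * V y
        ≤ ∑ y, polMat Pstar π x y * V y + ∑ a, π x a * (K * e x a) := by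
      rw [aux_expand, aux_expand, ← Finset.sum_add_distrib]
      refine Finset.sum_le_sum fun a _ => ?_
      rw [← mul_add]
      refine mul_le_mul_of_nonneg_left ?_ (hπ.1 x a)
      have hK0 : 0 ≤ K := (abs_nonneg _).trans (hVb x)
      have : ∑ y, (Phat x a y * V y - Pstar x a y * V y) ≤ K * e x a := by
        calc _ ≤ ∑ y, K * |Pstar x a y - Phat x a y| := Finset.sum_le_sum fun y _ => by
              rw [← sub_mul]
              refine (le_abs_self _).trans ?_
              rw [abs_mul, abs_sub_comm, mul_comm]
              exact mul_le_mul_of_nonneg_right (hVb y) (abs_nonneg _)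
          _ = K * ∑ y, |Pstar x a y - Phat x a y| := by rw [Finset.mul_sum]
          _ ≤ _ := mul_le_mul_of_nonneg_left (hAsm x a) hK0
      rw [Finset.sum_sub_distrib] at this
      linarith
    have e4 : polRew rhat π x = polRew r π x - γ * ∑ a, π x a * (K * e x a) := by
      simp only [polRew, Finset.mul_sum, ← Finset.sum_sub_distrib]
      refine Finset.sum_congr rfl fun a _ => ?_
      rw [hrhat, hK]
      ring
    have e5 := mul_le_mul_of_nonneg_left e3 hγ0
    simp only [mul_sub, Finset.sum_sub_distrib]
    linarith) x
  linarith
end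

section
/- (Theorem 5 of the paper: safety and performance loss of the distributionally robust baseline-improvement solution.) Assume Assumption 1 holds, let U(P̂, e) be the set of all transition kernels P with ∑_{x'} |P x a x' − P̂ x a x'| ≤ e x a for all x, a, let π_B be any (baseline) policy, and for a policy π define D(π) as the infimum (Real.sInf) of the set {ρ(π, P, r) − ρ(π_B, P, r) : P ∈ U(P̂, e)} (this set is nonempty and bounded below). Let π_I be a policy with D(π_I) ≥ D(π) for every policy π, and let π⋆ be a policy maximizing the true return, i.e., ρ(π⋆, P⋆, r) ≥ ρ(π, P⋆, r) for every policy π. Then: (i) π_I is safe, i.e., ρ(π_I, P⋆, r) ≥ ρ(π_B, P⋆, r); and (ii) ρ(π⋆, P⋆, r) − ρ(π_I, P⋆, r) ≤ min{ (2·γ·Rmax/(1−γ)²) · ( ∑_x u^{π⋆}_{P⋆} x · e_{π⋆} x + ∑_x u^{π_B}_{P⋆} x · e_{π_B} x ) , ρ(π⋆, P⋆, r) − ρ(π_B, P⋆, r) }. -/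
open Matrix

/-- The distributionally robust improvement over a baseline policy:
`D(π) = inf { ρ(π, P, r) − ρ(π_B, P, r) : P ∈ U(P̂, e) }`. -/
noncomputable def robustImprovement {X A : Type*} [Fintype X] [DecidableEq X] [Fintype A]
    (p0 : X → ℝ) (γ : ℝ) (Phat : X → A → X → ℝ) (e : X → A → ℝ)
    (r : X → A → ℝ) (πB : X → A → ℝ) (π : X → A → ℝ) : ℝ :=
  sInf {v : ℝ | ∃ P : X → A → X → ℝ, IsKernel P ∧
    (∀ x a, ∑ x', |P x a x' - Phat x a x'| ≤ e x a) ∧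
    v = ret p0 γ P r π - ret p0 γ P r πB}

/-- Minimum principle for a row-stochastic matrix. -/
lemma min_principle {X : Type*} [Fintype X] [Nonempty X] (γ : ℝ) (hγ0 : 0 ≤ γ) (hγ1 : γ < 1)
    (M : Matrix X X ℝ) (hM0 : ∀ x y, 0 ≤ M x y) (hM1 : ∀ x, ∑ y, M x y = 1)
    (v : X → ℝ) (hv : ∀ x, γ * ∑ y, M x y * v y ≤ v x) : ∀ x, 0 ≤ v x := by
  obtain ⟨x0, hx0⟩ := Finite.exists_min v
  have h1 : v x0 ≤ ∑ y, M x0 y * v y := by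
    calc v x0 = ∑ y, M x0 y * v x0 := by rw [← Finset.sum_mul, hM1, one_mul]
      _ ≤ _ := Finset.sum_le_sum fun y _ => mul_le_mul_of_nonneg_left (hx0 y) (hM0 _ _)
  have h2 := hv x0
  have h3 := mul_le_mul_of_nonneg_left h1 hγ0
  have h4 : 0 ≤ v x0 := by
    by_contra h
    push Not at h
    nlinarith
  exact fun x => h4.trans (hx0 x)

lemma mulVec_apply' {X : Type*} [Fintype X] [DecidableEq X] (γ : ℝ)
    (M : Matrix X X ℝ) (v : X → ℝ) (x : X) :
    (((1 : Matrix X X ℝ) - γ • M) *ᵥ v) x = v x - γ * ∑ y, M x y * v y := by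
  rw [Matrix.sub_mulVec, Matrix.one_mulVec, Matrix.smul_mulVec]
  simp [Matrix.mulVec, dotProduct]

lemma isUnit_det_res {X : Type*} [Fintype X] [DecidableEq X] [Nonempty X]
    (γ : ℝ) (hγ0 : 0 ≤ γ) (hγ1 : γ < 1)
    (M : Matrix X X ℝ) (hM0 : ∀ x y, 0 ≤ M x y) (hM1 : ∀ x, ∑ y, M x y = 1) :
    IsUnit ((1 : Matrix X X ℝ) - γ • M).det := by
  rw [← Matrix.isUnit_iff_isUnit_det, ← Matrix.mulVec_injective_iff_isUnit]
  have key : ∀ v w : X → ℝ, ((1 : Matrix X X ℝ) - γ • M) *ᵥ v = ((1 : Matrix X X ℝ) - γ • M) *ᵥ w →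
      ∀ x, 0 ≤ (v - w) x := by
    intro v w h
    apply min_principle γ hγ0 hγ1 M hM0 hM1
    intro x
    have h0 : (((1 : Matrix X X ℝ) - γ • M) *ᵥ (v - w)) x = 0 := by
      rw [Matrix.mulVec_sub, h, sub_self]; rfl
    rw [mulVec_apply'] at h0
    linarith
  intro v w h
  funext x
  have h1 := key v w h x
  have h2 := key w v h.symm x
  simp only [Pi.sub_apply] at h1 h2
  linarith

lemma inv_nonneg_res {X : Type*} [Fintype X] [DecidableEq X] [Nonempty X]
    (γ : ℝ) (hγ0 : 0 ≤ γ) (hγ1 : γ < 1)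
    (M : Matrix X X ℝ) (hM0 : ∀ x y, 0 ≤ M x y) (hM1 : ∀ x, ∑ y, M x y = 1) (x j : X) :
    0 ≤ ((1 : Matrix X X ℝ) - γ • M)⁻¹ x j := by
  refine min_principle γ hγ0 hγ1 M hM0 hM1 (fun x => ((1 : Matrix X X ℝ) - γ • M)⁻¹ x j) ?_ x
  intro x
  have h := Matrix.mul_nonsing_inv _ (isUnit_det_res γ hγ0 hγ1 M hM0 hM1)
  have h1 := congrFun (congrFun h x) j
  have h2 : (((1 : Matrix X X ℝ) - γ • M) *ᵥ
      (fun x => ((1 : Matrix X X ℝ) - γ • M)⁻¹ x j)) x = (1 : Matrix X X ℝ) x j := h1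
  rw [mulVec_apply'] at h2
  have h3 : 0 ≤ (1 : Matrix X X ℝ) x j := by
    rw [Matrix.one_apply]; split_ifs <;> norm_num
  linarith

lemma polMat_stoch {X A : Type*} [Fintype X] [Fintype A]
    {P : X → A → X → ℝ} (hP : IsKernel P) {π : X → A → ℝ} (hπ : IsPolicy π) :
    (∀ x y, 0 ≤ polMat P π x y) ∧ ∀ x, ∑ y, polMat P π x y = 1 := by
  constructor
  · intro x y
    exact Finset.sum_nonneg fun a _ => mul_nonneg (hπ.1 _ _) (hP.1 _ _ _)
  · intro x
    simp only [polMat, Matrix.of_apply]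
    rw [Finset.sum_comm]
    simp only [← Finset.mul_sum, hP.2, mul_one, hπ.2]

lemma valueFn_eq {X A : Type*} [Fintype X] [Nonempty X] [DecidableEq X] [Fintype A]
    {γ : ℝ} (hγ0 : 0 ≤ γ) (hγ1 : γ < 1) (r : X → A → ℝ)
    {P : X → A → X → ℝ} (hP : IsKernel P) {π : X → A → ℝ} (hπ : IsPolicy π) (x : X) :
    valueFn γ P r π x - γ * ∑ y, polMat P π x y * valueFn γ P r π y = polRew r π x := by
  obtain ⟨h0, h1⟩ := polMat_stoch hP hπ
  rw [← mulVec_apply', valueFn, Matrix.mulVec_mulVec,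
    Matrix.mul_nonsing_inv _ (isUnit_det_res γ hγ0 hγ1 _ h0 h1), Matrix.one_mulVec]

lemma valueFn_bound {X A : Type*} [Fintype X] [Nonempty X] [DecidableEq X] [Fintype A]
    {γ : ℝ} (hγ0 : 0 ≤ γ) (hγ1 : γ < 1) {Rmax : ℝ}
    {r : X → A → ℝ} (hr : ∀ x a, |r x a| ≤ Rmax)
    {P : X → A → X → ℝ} (hP : IsKernel P) {π : X → A → ℝ} (hπ : IsPolicy π) (x : X) :
    |valueFn γ P r π x| ≤ Rmax / (1 - γ) := by
  obtain ⟨h0, h1⟩ := polMat_stoch hP hπ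
  have hrew : ∀ x, |polRew r π x| ≤ Rmax := by
    intro x
    calc |polRew r π x| ≤ ∑ a, |π x a * r x a| := Finset.abs_sum_le_sum_abs _ _
      _ ≤ ∑ a, π x a * Rmax := Finset.sum_le_sum fun a _ => by
          rw [abs_mul, abs_of_nonneg (hπ.1 x a)]
          exact mul_le_mul_of_nonneg_left (hr x a) (hπ.1 x a)
      _ = Rmax := by rw [← Finset.sum_mul, hπ.2, one_mul]
  set c := Rmax / (1 - γ) with hc
  have hcR : c - γ * c = Rmax := by
    have : (1 - γ) ≠ 0 := by linarith
    rw [hc]; field_simp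
  have e1 := min_principle γ hγ0 hγ1 _ h0 h1 (fun x => c - valueFn γ P r π x) (by
    intro x
    have h := valueFn_eq hγ0 hγ1 r hP hπ x
    have hb := abs_le.1 (hrew x)
    simp only [mul_sub, Finset.sum_sub_distrib, ← Finset.sum_mul, h1, one_mul]
    linarith) x
  have e2 := min_principle γ hγ0 hγ1 _ h0 h1 (fun x => c + valueFn γ P r π x) (by
    intro x
    have h := valueFn_eq hγ0 hγ1 r hP hπ x
    have hb := abs_le.1 (hrew x)
    simp only [mul_add, Finset.sum_add_distrib, ← Finset.sum_mul, h1, one_mul]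
    linarith) x
  exact abs_le.2 ⟨by linarith, by linarith⟩

lemma ret_diff {X A : Type*} [Fintype X] [Nonempty X] [DecidableEq X] [Fintype A]
    {γ : ℝ} (hγ0 : 0 ≤ γ) (hγ1 : γ < 1) {Rmax : ℝ} (hR : 0 ≤ Rmax)
    {r : X → A → ℝ} (hr : ∀ x a, |r x a| ≤ Rmax)
    {p0 : X → ℝ} (hp0 : ∀ x, 0 ≤ p0 x)
    {Ps P : X → A → X → ℝ} (hPs : IsKernel Ps) (hP : IsKernel P)
    {e : X → A → ℝ} (he : ∀ x a, ∑ x', |Ps x a x' - P x a x'| ≤ 2 * e x a)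
    {π : X → A → ℝ} (hπ : IsPolicy π) :
    |ret p0 γ Ps r π - ret p0 γ P r π| ≤
      2 * γ * Rmax / (1 - γ) ^ 2 * ∑ x, occupancy p0 γ Ps π x * polErr e π x := by
  obtain ⟨h0, h1⟩ := polMat_stoch hPs hπ
  have hg : 0 < 1 - γ := by linarith
  set N := ((1 : Matrix X X ℝ) - γ • polMat Ps π)⁻¹ with hN
  set V := valueFn γ P r π with hV
  set w : X → ℝ := fun x => γ * ∑ y, (polMat Ps π x y - polMat P π x y) * V y with hw
  have hdet := isUnit_det_res γ hγ0 hγ1 _ h0 h1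
  have hd : valueFn γ Ps r π - V = N *ᵥ w := by
    have h : ((1 : Matrix X X ℝ) - γ • polMat Ps π) *ᵥ (valueFn γ Ps r π - V) = w := by
      funext x
      have a1 := valueFn_eq hγ0 hγ1 r hPs hπ x
      have a2 := valueFn_eq hγ0 hγ1 r hP hπ x
      rw [mulVec_apply']
      simp only [hw, Pi.sub_apply, mul_sub, sub_mul, Finset.sum_sub_distrib]
      linarith
    rw [← h, Matrix.mulVec_mulVec, hN, Matrix.nonsing_inv_mul _ hdet, Matrix.one_mulVec]
  have hwb : ∀ x, |w x| ≤ γ * (Rmax / (1 - γ)) * (2 * polErr e π x) := by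
    intro x
    have hc : 0 ≤ Rmax / (1 - γ) := by positivity
    have b1 : ∑ y, |polMat Ps π x y - polMat P π x y| ≤ 2 * polErr e π x := by
      calc ∑ y, |polMat Ps π x y - polMat P π x y|
          ≤ ∑ y, ∑ a, π x a * |Ps x a y - P x a y| := by
            refine Finset.sum_le_sum fun y _ => ?_
            simp only [polMat, Matrix.of_apply, ← Finset.sum_sub_distrib, ← mul_sub]
            refine (Finset.abs_sum_le_sum_abs _ _).trans (le_of_eq ?_)
            refine Finset.sum_congr rfl fun a _ => ?_
            rw [abs_mul, abs_of_nonneg (hπ.1 x a)]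
        _ = ∑ a, π x a * ∑ y, |Ps x a y - P x a y| := by
            rw [Finset.sum_comm]; simp only [Finset.mul_sum]
        _ ≤ ∑ a, π x a * (2 * e x a) :=
            Finset.sum_le_sum fun a _ => mul_le_mul_of_nonneg_left (he x a) (hπ.1 x a)
        _ = 2 * polErr e π x := by
            rw [polErr, Finset.mul_sum]
            exact Finset.sum_congr rfl fun a _ => by ring
    have b2 : |∑ y, (polMat Ps π x y - polMat P π x y) * V y| ≤
        2 * polErr e π x * (Rmax / (1 - γ)) := by
      refine (Finset.abs_sum_le_sum_abs _ _).trans ?_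
      refine le_trans ?_ (mul_le_mul_of_nonneg_right b1 hc)
      rw [Finset.sum_mul]
      refine Finset.sum_le_sum fun y _ => ?_
      rw [abs_mul]
      exact mul_le_mul_of_nonneg_left (valueFn_bound hγ0 hγ1 hr hP hπ y) (abs_nonneg _)
    simp only [hw]
    rw [abs_mul, abs_of_nonneg hγ0]
    refine (mul_le_mul_of_nonneg_left b2 hγ0).trans (le_of_eq (by ring))
  have hret : ret p0 γ Ps r π - ret p0 γ P r π = ∑ x, (∑ y, p0 y * N y x) * w x := by
    rw [ret, ret, ← Finset.sum_sub_distrib]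
    have : ∀ y, p0 y * valueFn γ Ps r π y - p0 y * V y = ∑ x, p0 y * N y x * w x := by
      intro y
      rw [← mul_sub, ← Pi.sub_apply, hd, Matrix.mulVec, dotProduct, Finset.mul_sum]
      exact Finset.sum_congr rfl fun a _ => by ring
    rw [Finset.sum_congr rfl fun y _ => this y, Finset.sum_comm]
    simp only [Finset.sum_mul]
  rw [hret, Finset.mul_sum]
  refine (Finset.abs_sum_le_sum_abs _ _).trans (Finset.sum_le_sum fun x _ => ?_)
  have hs : 0 ≤ ∑ y, p0 y * N y x :=
    Finset.sum_nonneg fun y _ => mul_nonneg (hp0 y) (inv_nonneg_res γ hγ0 hγ1 _ h0 h1 y x)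
  rw [abs_mul, abs_of_nonneg hs]
  refine (mul_le_mul_of_nonneg_left (hwb x) hs).trans (le_of_eq ?_)
  rw [occupancy, ← hN]
  field_simp

/-- Theorem 5: safety and performance loss of the distributionally
robust baseline-improvement solution. -/
theorem dro_safe_and_perf_loss
    {X A : Type*} [Fintype X] [Nonempty X] [DecidableEq X] [Fintype A] [Nonempty A]
    (γ : ℝ) (hγ0 : 0 ≤ γ) (hγ1 : γ < 1)
    (Rmax : ℝ) (hR : 0 ≤ Rmax)
    (r : X → A → ℝ) (hr : ∀ x a, |r x a| ≤ Rmax)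
    (p0 : X → ℝ) (hp0 : ∀ x, 0 ≤ p0 x) (hp1 : ∑ x, p0 x = 1)
    (Pstar Phat : X → A → X → ℝ) (hPstar : IsKernel Pstar) (hPhat : IsKernel Phat)
    (e : X → A → ℝ)
    (hAsm : ∀ x a, ∑ x', |Pstar x a x' - Phat x a x'| ≤ e x a)
    (πB : X → A → ℝ) (hπB : IsPolicy πB)
    (πI : X → A → ℝ) (hπI : IsPolicy πI)
    (hπIopt : ∀ π : X → A → ℝ, IsPolicy π →
      robustImprovement p0 γ Phat e r πB π ≤ robustImprovement p0 γ Phat e r πB πI)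
    (πstar : X → A → ℝ) (hπstar : IsPolicy πstar)
    (hπstaropt : ∀ π : X → A → ℝ, IsPolicy π → ret p0 γ Pstar r π ≤ ret p0 γ Pstar r πstar) :
    ret p0 γ Pstar r πI ≥ ret p0 γ Pstar r πB ∧
      ret p0 γ Pstar r πstar - ret p0 γ Pstar r πI ≤
        min (2 * γ * Rmax / (1 - γ) ^ 2 *
            (∑ x, occupancy p0 γ Pstar πstar x * polErr e πstar x +
              ∑ x, occupancy p0 γ Pstar πB x * polErr e πB x))
          (ret p0 γ Pstar r πstar - ret p0 γ Pstar r πB) := by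
  have htri : ∀ P : X → A → X → ℝ, (∀ x a, ∑ x', |P x a x' - Phat x a x'| ≤ e x a) →
      ∀ x a, ∑ x', |Pstar x a x' - P x a x'| ≤ 2 * e x a := by
    intro P hP x a
    calc ∑ x', |Pstar x a x' - P x a x'|
        ≤ ∑ x', (|Pstar x a x' - Phat x a x'| + |P x a x' - Phat x a x'|) := by
          refine Finset.sum_le_sum fun y _ => ?_
          rw [abs_sub_comm (P x a y)]
          exact abs_sub_le _ _ _
      _ ≤ 2 * e x a := by
          rw [Finset.sum_add_distrib]
          linarith [hAsm x a, hP x a]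
  have hlow : ∀ π : X → A → ℝ, IsPolicy π → ∀ P : X → A → X → ℝ, IsKernel P →
      (∀ x a, ∑ x', |P x a x' - Phat x a x'| ≤ e x a) →
      (ret p0 γ Pstar r π - ret p0 γ Pstar r πB) - 2 * γ * Rmax / (1 - γ) ^ 2 *
            (∑ x, occupancy p0 γ Pstar π x * polErr e π x +
              ∑ x, occupancy p0 γ Pstar πB x * polErr e πB x) ≤
        ret p0 γ P r π - ret p0 γ P r πB := by
    intro π hπ P hK hP
    have h1 := (abs_le.1 (ret_diff hγ0 hγ1 hR hr hp0 hPstar hK (htri P hP) hπ)).2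
    have h2 := (abs_le.1 (ret_diff hγ0 hγ1 hR hr hp0 hPstar hK (htri P hP) hπB)).1
    rw [mul_add]
    linarith
  have hDI : robustImprovement p0 γ Phat e r πB πI ≤
      ret p0 γ Pstar r πI - ret p0 γ Pstar r πB := by
    refine csInf_le ⟨((ret p0 γ Pstar r πI - ret p0 γ Pstar r πB) - 2 * γ * Rmax / (1 - γ) ^ 2 *
            (∑ x, occupancy p0 γ Pstar πI x * polErr e πI x +
              ∑ x, occupancy p0 γ Pstar πB x * polErr e πB x)), ?_⟩ ⟨Pstar, hPstar, hAsm, rfl⟩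
    rintro v ⟨P, hK, hP, rfl⟩
    exact hlow πI hπI P hK hP
  have hDB : 0 ≤ robustImprovement p0 γ Phat e r πB πB := by
    refine le_csInf ⟨_, Pstar, hPstar, hAsm, rfl⟩ ?_
    rintro v ⟨P, hK, hP, rfl⟩
    rw [sub_self]
  have hDS := le_csInf (a := ((ret p0 γ Pstar r πstar - ret p0 γ Pstar r πB) - 2 * γ * Rmax / (1 - γ) ^ 2 *
            (∑ x, occupancy p0 γ Pstar πstar x * polErr e πstar x +
              ∑ x, occupancy p0 γ Pstar πB x * polErr e πB x)))
    (s := {v : ℝ | ∃ P : X → A → X → ℝ, IsKernel P ∧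
      (∀ x a, ∑ x', |P x a x' - Phat x a x'| ≤ e x a) ∧
      v = ret p0 γ P r πstar - ret p0 γ P r πB}) ⟨_, Pstar, hPstar, hAsm, rfl⟩ (by
    rintro v ⟨P, hK, hP, rfl⟩
    exact hlow πstar hπstar P hK hP)
  have hS := hπIopt πstar hπstar
  have hB := hπIopt πB hπB
  rw [robustImprovement] at hS
  refine ⟨by linarith, le_min (by linarith) (by linarith)⟩
end
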